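/- Let G be a finite simple graph on n ≥ 2 vertices, let b be a positive integer, and let D be an orientation of the multigraph G^b (G with every edge replaced by b parallel copies) such that d⁺(u) ≤ (1+x)·d⁺(v) for every directed edge u→v, where 0 < x ≤ 1/(100·log₂ n). Then the maximum out-degree of D satisfies Δ(D) ≤ 3·b·ρ(G), where ρ(G) is the maximum subgraph density of G. -/

import Mathlib

/-- The maximum subgraph density of a finite simple graph: the maximum over (nonempty)
vertex subsets `S` of `|E(S)| / |S|`, where `E(S)` is the set of edges of `G` with both
endpoints in `S`. -/
noncomputable def sdensity {V : Type*} [Fintype V] [DecidableEq V] (G : SimpleGraph V)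
    [DecidableRel G.Adj] : NNReal :=
  Finset.univ.powerset.sup fun S : Finset V =>
    (((G.edgeFinset ∩ S.sym2).card : NNReal)) / (S.card : NNReal)

open Finset in
/-- The number of ordered adjacent pairs inside `S` is at most twice the number of edges
inside `S`. -/
lemma card_adj_pairs_le {V : Type*} [Fintype V] [DecidableEq V] (G : SimpleGraph V)
    [DecidableRel G.Adj] (S : Finset V) :
    #{p ∈ S ×ˢ S | G.Adj p.1 p.2} ≤ 2 * #(G.edgeFinset ∩ S.sym2) := by
  refine card_le_mul_card_image_of_maps_to (f := fun p : V × V => s(p.1, p.2)) ?_ 2 ?_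
  · rintro ⟨u, v⟩ h
    simpa [and_comm] using h
  · intro e _
    induction e using Sym2.ind with
    | _ u v =>
      refine (card_le_card (t := {(u, v), (v, u)}) ?_).trans card_le_two
      rintro ⟨p, q⟩ h
      have h' := (mem_filter.1 h).2
      simpa using h'

open Finset in
/-- If each edge carries total weight `b`, the weight inside `S` is at most `b * |E(S)|`. -/
lemma sum_weight_le_card_edges {V : Type*} [Fintype V] [DecidableEq V] (G : SimpleGraph V)
    [DecidableRel G.Adj] {b : ℕ} {w : V → V → ℕ}
    (hsum : ∀ u v, G.Adj u v → w u v + w v u = b)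
    (hzero : ∀ u v, ¬ G.Adj u v → w u v = 0) (S : Finset V) :
    ∑ u ∈ S, ∑ v ∈ S, w u v ≤ b * #(G.edgeFinset ∩ S.sym2) := by
  have hpair : ∀ u v, w u v + w v u = if G.Adj u v then b else 0 := by
    intro u v
    split_ifs with h
    · exact hsum u v h
    · rw [hzero u v h, hzero v u fun h' => h h'.symm]
  have hcard : ∑ u ∈ S, ∑ v ∈ S, (w u v + w v u) = #{p ∈ S ×ˢ S | G.Adj p.1 p.2} * b := by
    simp_rw [hpair]
    rw [← sum_product' S S fun u v => if G.Adj u v then b else 0, ← sum_filter, sum_const,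
      smul_eq_mul]
  have hdouble : ∑ u ∈ S, ∑ v ∈ S, (w u v + w v u) = 2 * ∑ u ∈ S, ∑ v ∈ S, w u v := by
    simp_rw [sum_add_distrib]
    rw [sum_comm (f := fun u v => w v u), two_mul]
  have := Nat.mul_le_mul_right b (card_adj_pairs_le G S)
  rw [← hcard, hdouble] at this
  linarith

open Finset in
/-- The number of edges inside `S` is at most `sdensity G * |S|`. -/
lemma card_edges_le_sdensity_mul {V : Type*} [Fintype V] [DecidableEq V] (G : SimpleGraph V)
    [DecidableRel G.Adj] (S : Finset V) :
    (#(G.edgeFinset ∩ S.sym2) : ℝ) ≤ sdensity G * #S := by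
  rcases S.eq_empty_or_nonempty with rfl | hS
  · simp
  have h : (#(G.edgeFinset ∩ S.sym2) : NNReal) / #S ≤ sdensity G :=
    le_sup (f := fun S : Finset V => (#(G.edgeFinset ∩ S.sym2) : NNReal) / #S)
      (mem_powerset.2 (subset_univ S))
  have hpos : (0 : NNReal) < #S := by exact_mod_cast hS.card_pos
  exact_mod_cast (div_le_iff₀ hpos).1 h

/-- Powers of `1 + x` stay below `3 / 2` up to exponent `log₂ n` when
`x ≤ 1 / (100 * log₂ n)`. -/
lemma one_add_pow_le_three_halves {n i : ℕ} (hn : 2 ≤ n) {x : ℝ} (hx : 0 < x)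
    (hxle : x ≤ 1 / (100 * Real.logb 2 n)) (hi : i ≤ Nat.log 2 n) :
    (1 + x) ^ i ≤ 3 / 2 := by
  have hlog : (i : ℝ) ≤ Real.logb 2 n :=
    (Nat.cast_le.2 hi).trans (by exact_mod_cast Real.natLog_le_logb n 2)
  have hlogpos : 0 < Real.logb 2 n :=
    Real.logb_pos one_lt_two (by exact_mod_cast hn)
  have hix : i * x ≤ 1 / 100 := by
    rw [le_div_iff₀ (by positivity)] at hxle
    nlinarith
  calc (1 + x) ^ i ≤ Real.exp x ^ i := by
        gcongr
        linarith [Real.add_one_le_exp x]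
    _ = Real.exp (i * x) := (Real.exp_nat_mul x i).symm
    _ ≤ 1 / (1 - i * x) := by
        simpa using Real.exp_bound_div_one_sub_of_interval (by positivity) (by linarith)
    _ ≤ 3 / 2 := by
        rw [div_le_iff₀ (by linarith)]
        linarith

/-- Let `G` be a finite simple graph on `n ≥ 2` vertices, `b` a positive integer, and let
`D` be an orientation of the multigraph `G^b` (each edge of `G` replaced by `b` parallel
copies), encoded by `w : V → V → ℕ` where `w u v` counts the copies of `{u,v}` directed
from `u` to `v`; its out-degree is `d⁺(u) = ∑_z w u z` and its maximum out-degree is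
`Δ(D) = max_u d⁺(u)`. If `d⁺(u) ≤ (1+x)·d⁺(v)` for every directed edge `u → v` (i.e.
whenever `w u v ≥ 1`), where `0 < x ≤ 1/(100·log₂ n)`, then `Δ(D) ≤ 3·b·ρ(G)`. -/
theorem maxOutDeg_le_three_density
    {V : Type*} [Fintype V] [DecidableEq V] (G : SimpleGraph V) [DecidableRel G.Adj]
    (hn : 2 ≤ Fintype.card V)
    (b : ℕ) (hb : 0 < b)
    (w : V → V → ℕ)
    (hsum : ∀ u v, G.Adj u v → w u v + w v u = b)
    (hzero : ∀ u v, ¬ G.Adj u v → w u v = 0)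
    (x : ℝ) (hx : 0 < x)
    (hxle : x ≤ 1 / (100 * Real.logb 2 (Fintype.card V)))
    (hinv : ∀ u v, 1 ≤ w u v →
      ((∑ z, w u z : ℕ) : ℝ) ≤ (1 + x) * ((∑ z, w v z : ℕ) : ℝ)) :
    ((Finset.univ.sup fun u => ∑ z, w u z : ℕ) : ℝ) ≤ 3 * (b : ℝ) * (sdensity G : ℝ) := by
  set d : V → ℕ := fun u => ∑ z, w u z
  set Δ : ℕ := Finset.univ.sup d with hΔ
  set ρ : ℝ := (sdensity G : ℝ)
  have hρ0 : 0 ≤ ρ := NNReal.coe_nonneg _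
  by_contra! hlt
  have hΔpos : (0 : ℝ) < Δ := lt_of_le_of_lt (by positivity) hlt
  let T : ℕ → Finset V := fun i => {v | (Δ : ℝ) ≤ (1 + x) ^ i * d v}
  have hmem : ∀ i v, v ∈ T i ↔ (Δ : ℝ) ≤ (1 + x) ^ i * d v := fun i v => by simp [T]
  have hout : ∀ i, ∀ u ∈ T i, d u ≤ ∑ v ∈ T (i + 1), w u v := by
    intro i u hu
    refine (Finset.sum_subset (Finset.subset_univ _) fun v _ hv => ?_).ge
    by_contra hne
    refine hv ((hmem _ _).2 (((hmem _ _).1 hu).trans ?_))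
    rw [pow_succ, mul_assoc]
    gcongr
    exact hinv u v (Nat.one_le_iff_ne_zero.2 hne)
  have hsub : ∀ i, T i ⊆ T (i + 1) := by
    intro i v hv
    refine (hmem _ _).2 (((hmem _ _).1 hv).trans ?_)
    gcongr
    · linarith
    · omega
  have hedge : ∀ i, (∑ u ∈ T i, (d u : ℝ)) ≤ b * (ρ * (T (i + 1)).card) := by
    intro i
    have h : ∑ u ∈ T i, d u ≤ b * (G.edgeFinset ∩ (T (i + 1)).sym2).card :=
      ((Finset.sum_le_sum (hout i)).trans (Finset.sum_le_sum_of_subset (hsub i))).trans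
        (sum_weight_le_card_edges G hsum hzero _)
    calc (∑ u ∈ T i, (d u : ℝ)) ≤ b * (G.edgeFinset ∩ (T (i + 1)).sym2).card := by
          exact_mod_cast h
      _ ≤ _ := by
          gcongr
          exact card_edges_le_sdensity_mul G _
  have hstep : ∀ i ≤ Nat.log 2 (Fintype.card V), 2 * (T i).card ≤ (T (i + 1)).card := by
    intro i hi
    have h1 : ((T i).card : ℝ) * Δ ≤ (1 + x) ^ i * ∑ u ∈ T i, (d u : ℝ) := by
      rw [Finset.mul_sum, ← nsmul_eq_mul]
      exact Finset.card_nsmul_le_sum _ _ _ fun u hu => (hmem i u).1 hu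
    have h2 : ((T i).card : ℝ) * Δ ≤ 3 / 2 * (b * (ρ * (T (i + 1)).card)) :=
      h1.trans (mul_le_mul (one_add_pow_le_three_halves hn hx hxle hi) (hedge i)
        (by positivity) (by norm_num))
    have h3 : 3 * b * ρ * (T (i + 1)).card ≤ Δ * (T (i + 1)).card := by gcongr
    have h4 : (2 * (T i).card : ℝ) * Δ ≤ (T (i + 1)).card * Δ := by linarith
    exact_mod_cast le_of_mul_le_mul_right h4 hΔpos
  have hgrow : ∀ i ≤ Nat.log 2 (Fintype.card V) + 1, 2 ^ i ≤ (T i).card := by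
    intro i
    induction i with
    | zero =>
      intro _
      have : Nonempty V := Fintype.card_pos_iff.1 (by omega)
      obtain ⟨v, _, hv⟩ := Finset.exists_mem_eq_sup Finset.univ Finset.univ_nonempty d
      exact Finset.card_pos.2 ⟨v, (hmem 0 v).2 (by simp [hΔ, hv])⟩
    | succ i ih =>
      intro hi
      rw [pow_succ']
      exact (Nat.mul_le_mul_left 2 (ih (by omega))).trans (hstep i (by omega))
  exact (Nat.lt_pow_succ_log_self one_lt_two (Fintype.card V)).not_ge
    ((hgrow _ le_rfl).trans (Finset.card_le_univ _))
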